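/- Let n ≥ 3 be an integer, ν ≥ (n−2)/2 real, let k ≥ 0 be an integer, and let α ≥ max{k − (n−1)/2, 0}. For r, s > 0 let F_{r,s}(λ) = (rs)^{−(n−2)/2} J_ν(λr) J_ν(λs), a smooth function of λ > 0. Then there exists a constant C > 0 (independent of λ, r, s) such that for all λ, r, s > 0, (1+r)^{−α} (1+s)^{−α} |(d/dλ)^k F_{r,s}(λ)| ≤ C λ^{n−2−k} (1+λ)^k. -/

import Mathlib

open MeasureTheory Real Set

/-- The Bessel function of the first kind of order `ν`, defined by its power series
(with the convention `1/Γ = 0` at the poles of `Γ`). -/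
noncomputable def besselJ (ν : ℝ) (x : ℝ) : ℝ :=
  ∑' k : ℕ, ((-1 : ℝ) ^ k / ((k.factorial : ℝ) * Real.Gamma (ν + (k : ℝ) + 1))) *
    (x / 2) ^ (2 * (k : ℝ) + ν)

/-- The coefficients of the entire function `t ↦ t ^ (-ν / 2) * J_ν (2 * √t)`. -/
noncomputable def besselCoeff (ν : ℝ) (k : ℕ) : ℝ :=
  (-1 : ℝ) ^ k / ((k.factorial : ℝ) * Real.Gamma (ν + (k : ℝ) + 1))

/-- The entire function `t ↦ t ^ (-ν / 2) * J_ν (2 * √t)`. -/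
noncomputable def besselEntire (ν t : ℝ) : ℝ := ∑' k : ℕ, besselCoeff ν k * t ^ k

lemma besselCoeff_eq {ν : ℝ} (hν : 0 ≤ ν) (k : ℕ) :
    besselCoeff ν k = (ν + 1 + k) * besselCoeff (ν + 1) k := by
  have hpos : 0 < ν + k + 1 := by positivity
  have hΓ : Real.Gamma (ν + 1 + k + 1) = (ν + k + 1) * Real.Gamma (ν + k + 1) := by
    rw [← Real.Gamma_add_one hpos.ne']; ring_nf
  have hΓ0 := (Real.Gamma_pos_of_pos hpos).ne'
  have hk : (k.factorial : ℝ) ≠ 0 := by positivity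
  have hpos' : ν + 1 + k ≠ 0 := by positivity
  unfold besselCoeff
  rw [hΓ]
  field_simp
  ring

lemma succ_mul_besselCoeff_succ (ν : ℝ) (k : ℕ) :
    ((k : ℝ) + 1) * besselCoeff ν (k + 1) = -besselCoeff (ν + 1) k := by
  unfold besselCoeff
  have hk : (k.factorial : ℝ) ≠ 0 := by positivity
  have hk' : (k : ℝ) + 1 ≠ 0 := by positivity
  rw [Nat.factorial_succ, pow_succ]
  push_cast
  rw [show ν + ((k : ℝ) + 1) + 1 = ν + 1 + k + 1 by ring]
  rcases eq_or_ne (Real.Gamma (ν + 1 + k + 1)) 0 with h | h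
  · simp [h]
  · field_simp

lemma Gamma_add_one_le {ν : ℝ} (hν : 0 ≤ ν) (k : ℕ) :
    Real.Gamma (ν + 1) ≤ Real.Gamma (ν + k + 1) := by
  induction k with
  | zero => simp
  | succ k ih =>
    have hpos : 0 < ν + k + 1 := by positivity
    have h : Real.Gamma (ν + (k + 1 : ℕ) + 1) = (ν + k + 1) * Real.Gamma (ν + k + 1) := by
      rw [← Real.Gamma_add_one hpos.ne']; push_cast; ring_nf
    rw [h]
    have hk : (0 : ℝ) ≤ k := k.cast_nonneg
    nlinarith [Real.Gamma_pos_of_pos hpos]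

lemma abs_besselCoeff_le {ν : ℝ} (hν : 0 ≤ ν) (k : ℕ) :
    |besselCoeff ν k| ≤ (Real.Gamma (ν + 1))⁻¹ * (k.factorial : ℝ)⁻¹ := by
  have h0 : 0 < Real.Gamma (ν + 1) := Real.Gamma_pos_of_pos (by positivity)
  have h1 := Gamma_add_one_le hν k
  have h2 : 0 < Real.Gamma (ν + k + 1) := h0.trans_le h1
  unfold besselCoeff
  rw [abs_div, abs_pow, abs_neg, abs_one, one_pow, abs_of_pos (by positivity), one_div, mul_inv,
    mul_comm]
  gcongr

lemma summable_besselCoeff_mul_pow {ν : ℝ} (hν : 0 ≤ ν) (t : ℝ) :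
    Summable fun k : ℕ => besselCoeff ν k * t ^ k := by
  refine Summable.of_norm_bounded
    ((Real.summable_pow_div_factorial |t|).mul_left (Real.Gamma (ν + 1))⁻¹) fun k => ?_
  rw [norm_mul, norm_pow, Real.norm_eq_abs, Real.norm_eq_abs]
  calc _ ≤ ((Real.Gamma (ν + 1))⁻¹ * (k.factorial : ℝ)⁻¹) * |t| ^ k := by
        gcongr; exact abs_besselCoeff_le hν k
    _ = _ := by ring

lemma hasDerivAt_besselEntire {ν : ℝ} (hν : 0 ≤ ν) (t : ℝ) :
    HasDerivAt (besselEntire ν) (-besselEntire (ν + 1) t) t := by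
  set R := |t| + 1 with hR
  have hR0 : 0 < R := by positivity
  have hu : Summable fun k : ℕ =>
      (Real.Gamma (ν + 1))⁻¹ * ((k.factorial : ℝ)⁻¹ * (k * R ^ (k - 1))) := by
    refine Summable.mul_left _ ((summable_nat_add_iff 1).1 ?_)
    refine (Real.summable_pow_div_factorial R).congr fun k => ?_
    have : (k.factorial : ℝ) ≠ 0 := by positivity
    rw [Nat.factorial_succ]
    push_cast
    field_simp
  have h := hasDerivAt_tsum_of_isPreconnected (𝕜 := ℝ) (F := ℝ) (t := Metric.ball 0 R)
    (g := fun k y => besselCoeff ν k * y ^ k)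
    (g' := fun k y => besselCoeff ν k * (k * y ^ (k - 1))) (y₀ := 0) (y := t) hu
    Metric.isOpen_ball (convex_ball _ _).isPreconnected
    (fun k y _ => (hasDerivAt_pow k y).const_mul _)
    (fun k y hy => ?_) (Metric.mem_ball_self hR0) (summable_besselCoeff_mul_pow hν 0)
    (by simp [hR])
  · refine h.congr_deriv ?_
    have hs : HasSum (fun k : ℕ => besselCoeff ν (k + 1) * ((k + 1 : ℕ) * t ^ (k + 1 - 1)))
        (-besselEntire (ν + 1) t) := by
      refine ((summable_besselCoeff_mul_pow (ν := ν + 1) (by positivity) t).hasSum.neg).congr_fun ?_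
      intro k
      rw [Nat.add_sub_cancel, ← neg_mul, ← succ_mul_besselCoeff_succ]
      push_cast
      ring
    rw [((hasSum_nat_add_iff' (f := fun k : ℕ => besselCoeff ν k * (k * t ^ (k - 1))) 1).1
      (by simpa using hs)).tsum_eq]
  · rw [mem_ball_zero_iff, Real.norm_eq_abs] at hy
    rw [norm_mul, norm_mul, norm_pow, Real.norm_eq_abs, Real.norm_eq_abs, Real.norm_eq_abs,
      Nat.abs_cast, ← mul_assoc (Real.Gamma (ν + 1))⁻¹]
    gcongr
    exact abs_besselCoeff_le hν k

lemma besselEntire_eq {ν : ℝ} (hν : 0 ≤ ν) (t : ℝ) :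
    besselEntire ν t = (ν + 1) * besselEntire (ν + 1) t - t * besselEntire (ν + 2) t := by
  have h1 := (summable_besselCoeff_mul_pow (ν := ν + 1) (by positivity) t).hasSum.mul_left (ν + 1)
  have h2 := (summable_besselCoeff_mul_pow (ν := ν + 2) (by positivity) t).hasSum.mul_left (-t)
  have h3 : HasSum (fun k : ℕ => (k : ℝ) * besselCoeff (ν + 1) k * t ^ k)
      (-t * besselEntire (ν + 2) t) := by
    refine (hasSum_nat_add_iff' 1).1 ?_
    simp only [Finset.sum_range_one, CharP.cast_eq_zero, zero_mul, sub_zero]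
    refine h2.congr_fun fun k => ?_
    have := succ_mul_besselCoeff_succ (ν + 1) k
    rw [show ν + 1 + 1 = ν + 2 by ring] at this
    push_cast
    rw [this]
    ring
  rw [sub_eq_add_neg, ← neg_mul]
  refine ((h1.add h3).congr_fun fun k => ?_).tsum_eq
  rw [besselCoeff_eq hν]
  ring

lemma besselJ_eq (ν : ℝ) {x : ℝ} (hx : 0 < x) :
    besselJ ν x = (x / 2) ^ ν * besselEntire ν ((x / 2) ^ 2) := by
  unfold besselJ besselEntire besselCoeff
  rw [← tsum_mul_left]
  refine tsum_congr fun k => ?_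
  rw [Real.rpow_add (by positivity), show (2 * (k : ℝ)) = ((2 * k : ℕ) : ℝ) by push_cast; rfl,
    Real.rpow_natCast, pow_mul]
  ring

lemma hasDerivAt_besselJ {ν : ℝ} (hν : 0 ≤ ν) {x : ℝ} (hx : 0 < x) :
    HasDerivAt (besselJ ν) (ν / x * besselJ ν x - besselJ (ν + 1) x) x := by
  have hx2 : 0 < x / 2 := by positivity
  have h1 : HasDerivAt (fun y : ℝ => y / 2) (1 / 2) x := (hasDerivAt_id x).div_const 2
  have h2 := h1.rpow_const (p := ν) (Or.inl hx2.ne')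
  have h3 := (hasDerivAt_besselEntire hν ((x / 2) ^ 2)).comp x (h1.pow 2)
  have h4 := (h2.mul h3).congr_of_eventuallyEq (f₁ := besselJ ν) (by
    filter_upwards [lt_mem_nhds hx] with y hy using besselJ_eq ν hy)
  refine h4.congr_deriv ?_
  rw [besselJ_eq ν hx, besselJ_eq (ν + 1) hx, Real.rpow_sub_one hx2.ne', Real.rpow_add_one hx2.ne']
  simp only [Function.comp, Pi.pow_apply]
  field_simp
  ring

lemma besselJ_three_term {ν : ℝ} (hν : 0 ≤ ν) {x : ℝ} (hx : 0 < x) :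
    besselJ ν x = 2 * (ν + 1) / x * besselJ (ν + 1) x - besselJ (ν + 2) x := by
  have hx2 : 0 < x / 2 := by positivity
  rw [besselJ_eq ν hx, besselJ_eq (ν + 1) hx, besselJ_eq (ν + 2) hx, besselEntire_eq hν,
    Real.rpow_add_one hx2.ne', Real.rpow_add hx2, Real.rpow_two]
  field_simp

lemma hasDerivAt_besselJ_add_one {ν : ℝ} (hν : 0 ≤ ν) {x : ℝ} (hx : 0 < x) :
    HasDerivAt (besselJ (ν + 1)) (besselJ ν x - (ν + 1) / x * besselJ (ν + 1) x) x := by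
  convert hasDerivAt_besselJ (ν := ν + 1) (by positivity) hx using 1
  rw [besselJ_three_term hν hx, show ν + 1 + 1 = ν + 2 by ring]
  ring

lemma exists_abs_besselJ_le_rpow {ν : ℝ} (hν : 0 ≤ ν) :
    ∃ C : ℝ, 0 ≤ C ∧ ∀ x : ℝ, 0 < x → x ≤ 1 → |besselJ ν x| ≤ C * x ^ ν := by
  have hc : Continuous (besselEntire ν) :=
    continuous_iff_continuousAt.2 fun t => (hasDerivAt_besselEntire hν t).continuousAt
  obtain ⟨C, hC⟩ := (isCompact_Icc (a := (0 : ℝ)) (b := 1)).exists_bound_of_continuousOn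
    hc.continuousOn
  have hC0 : 0 ≤ C := (norm_nonneg _).trans (hC 0 (by simp))
  refine ⟨C, hC0, fun x hx hx1 => ?_⟩
  rw [besselJ_eq ν hx, abs_mul, abs_of_pos (by positivity), mul_comm]
  gcongr
  · exact hC _ ⟨by positivity, by nlinarith⟩
  · linarith

/-- The energy `u ^ 2 + u' ^ 2` of `u = √x * J_ν x`, which solves
`u'' + (1 - (ν ^ 2 - 1 / 4) / x ^ 2) * u = 0`, gives the decay of `J_ν` at infinity. -/
lemma exists_abs_besselJ_le_rpow_neg_half {ν : ℝ} (hν : 0 ≤ ν) :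
    ∃ C : ℝ, 0 ≤ C ∧ ∀ x : ℝ, 1 ≤ x → |besselJ ν x| ≤ C * x ^ (-(1 / 2) : ℝ) := by
  set κ := ν + 1 / 2 with hκ
  set c := |κ ^ 2 - κ| with hc
  let u : ℝ → ℝ := fun x => x ^ (1 / 2 : ℝ) * besselJ ν x
  let v : ℝ → ℝ := fun x => x ^ (1 / 2 : ℝ) * besselJ (ν + 1) x
  let w : ℝ → ℝ := fun x => κ / x * u x - v x
  let G : ℝ → ℝ := fun x => (u x ^ 2 + w x ^ 2) * Real.exp (c / x)
  have hu : ∀ x, 0 < x → HasDerivAt u (w x) x := fun x hx => by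
    refine HasDerivAt.congr_deriv ((Real.hasDerivAt_rpow_const (p := 1 / 2) (Or.inl hx.ne')).mul
      (hasDerivAt_besselJ hν hx)) ?_
    simp only [w, u, v, hκ]
    rw [Real.rpow_sub_one hx.ne']
    field_simp
    ring
  have hv : ∀ x, 0 < x → HasDerivAt v (u x - κ / x * v x) x := fun x hx => by
    refine HasDerivAt.congr_deriv ((Real.hasDerivAt_rpow_const (p := 1 / 2) (Or.inl hx.ne')).mul
      (hasDerivAt_besselJ_add_one hν hx)) ?_
    simp only [u, v, hκ]
    rw [Real.rpow_sub_one hx.ne']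
    field_simp
    ring
  have hw : ∀ x, 0 < x → HasDerivAt w (-u x + (κ ^ 2 - κ) / x ^ 2 * u x) x := fun x hx => by
    refine HasDerivAt.congr_deriv ((((hasDerivAt_const x κ).div (hasDerivAt_id x) hx.ne').mul (hu x hx)).sub
      (hv x hx)) ?_
    simp only [w, Pi.div_apply, id]
    field_simp
    ring
  have hG : ∀ x, 0 < x → HasDerivAt G
      ((2 * (κ ^ 2 - κ) * (u x * w x) - c * (u x ^ 2 + w x ^ 2)) / x ^ 2 * Real.exp (c / x)) x :=
    fun x hx => by
      refine HasDerivAt.congr_deriv ((((hu x hx).pow 2).add ((hw x hx).pow 2)).mul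
        ((hasDerivAt_const x c).div (hasDerivAt_id x) hx.ne').exp) ?_
      simp only [id, Pi.add_apply, Pi.pow_apply, Pi.div_apply]
      field_simp
      ring
  have hanti : AntitoneOn G (Ici 1) := by
    refine antitoneOn_of_deriv_nonpos (convex_Ici 1)
      (fun x hx => (hG x (one_pos.trans_le hx)).continuousAt.continuousWithinAt)
      (fun x hx => (hG x (one_pos.trans_le
        (interior_subset hx))).differentiableAt.differentiableWithinAt) fun x hx => ?_
    have hx0 : 0 < x := one_pos.trans_le (interior_subset hx)
    rw [(hG x hx0).deriv]
    refine mul_nonpos_of_nonpos_of_nonneg (div_nonpos_of_nonpos_of_nonneg ?_ (by positivity))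
      (Real.exp_pos _).le
    have h1 : 2 * (κ ^ 2 - κ) * (u x * w x) ≤ c * |2 * (u x * w x)| := by
      rw [hc, ← abs_mul]
      exact (le_abs_self _).trans_eq (by ring_nf)
    have h2 : |2 * (u x * w x)| ≤ u x ^ 2 + w x ^ 2 := by
      rw [abs_le]
      constructor <;> nlinarith [sq_nonneg (u x + w x), sq_nonneg (u x - w x)]
    have h3 : c * |2 * (u x * w x)| ≤ c * (u x ^ 2 + w x ^ 2) := by gcongr
    linarith
  refine ⟨Real.sqrt (G 1), Real.sqrt_nonneg _, fun x hx => ?_⟩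
  have hx0 : 0 < x := one_pos.trans_le hx
  have h1 : u x ^ 2 ≤ G 1 := by
    refine le_trans ?_ (hanti self_mem_Ici hx hx)
    have : 1 ≤ Real.exp (c / x) := Real.one_le_exp (by positivity)
    simp only [G]
    nlinarith [sq_nonneg (u x), sq_nonneg (w x)]
  have h2 : |u x| ≤ Real.sqrt (G 1) := Real.abs_le_sqrt h1
  have h3 : |besselJ ν x| = |u x| * x ^ (-(1 / 2) : ℝ) := by
    simp only [u]
    rw [abs_mul, abs_of_pos (Real.rpow_pos_of_pos hx0 _), Real.rpow_neg hx0.le]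
    field_simp
  rw [h3]
  gcongr

lemma exists_rpow_mul_abs_besselJ_le {ν m : ℝ} (hν : 0 ≤ ν) (hm : m ≤ ν) (a : ℕ) :
    ∃ C : ℝ, 0 ≤ C ∧ ∀ x : ℝ, 0 < x → x ^ ((a : ℝ) - m) * |besselJ (ν + a) x| ≤
      C * (1 + x) ^ max ((a : ℝ) - m - 1 / 2) 0 := by
  have hνa : 0 ≤ ν + a := by positivity
  obtain ⟨C₁, hC₁, h₁⟩ := exists_abs_besselJ_le_rpow hνa
  obtain ⟨C₂, hC₂, h₂⟩ := exists_abs_besselJ_le_rpow_neg_half hνa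
  refine ⟨max C₁ C₂, le_max_of_le_left hC₁, fun x hx => ?_⟩
  rcases le_total x 1 with hx1 | hx1
  · have ha : (0 : ℝ) ≤ a := a.cast_nonneg
    calc x ^ ((a : ℝ) - m) * |besselJ (ν + a) x|
        ≤ x ^ ((a : ℝ) - m) * (C₁ * x ^ (ν + a)) := by gcongr; exact h₁ x hx hx1
      _ = C₁ * x ^ ((a : ℝ) - m + (ν + a)) := by rw [Real.rpow_add hx ((a : ℝ) - m)]; ring
      _ ≤ C₁ * 1 := by
          gcongr
          exact Real.rpow_le_one hx.le hx1 (by linarith)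
      _ ≤ max C₁ C₂ * (1 + x) ^ max ((a : ℝ) - m - 1 / 2) 0 := by
          gcongr
          · exact le_max_left _ _
          · exact Real.one_le_rpow (by linarith) (le_max_right _ _)
  · calc x ^ ((a : ℝ) - m) * |besselJ (ν + a) x|
        ≤ x ^ ((a : ℝ) - m) * (C₂ * x ^ (-(1 / 2) : ℝ)) := by gcongr; exact h₂ x hx1
      _ = C₂ * x ^ ((a : ℝ) - m - 1 / 2) := by
          rw [sub_eq_add_neg ((a : ℝ) - m), Real.rpow_add hx]; ring
      _ ≤ C₂ * x ^ max ((a : ℝ) - m - 1 / 2) 0 := by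
          gcongr
          exact le_max_left _ _
      _ ≤ max C₁ C₂ * (1 + x) ^ max ((a : ℝ) - m - 1 / 2) 0 := by
          gcongr
          · exact le_max_right _ _
          · linarith

lemma exists_weighted_besselJ_le {ν m α : ℝ} (hν : 0 ≤ ν) (hm0 : 0 ≤ m) (hm : m ≤ ν) (a : ℕ)
    (hα : max ((a : ℝ) - m - 1 / 2) 0 ≤ α) :
    ∃ C : ℝ, 0 ≤ C ∧ ∀ l r : ℝ, 0 < l → 0 < r →
      (1 + r) ^ (-α) * (r ^ (-m) * |r ^ a * besselJ (ν + a) (l * r)|) ≤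
        C * l ^ (m - a) * (1 + l) ^ a := by
  obtain ⟨C, hC, h⟩ := exists_rpow_mul_abs_besselJ_le hν hm a
  refine ⟨C, hC, fun l r hl hr => ?_⟩
  set β := max ((a : ℝ) - m - 1 / 2) 0 with hβ
  have hβ0 : 0 ≤ β := le_max_right _ _
  have ha : (0 : ℝ) ≤ a := a.cast_nonneg
  have hβa : β ≤ a := max_le (by linarith) ha
  have hlr : 0 < l * r := by positivity
  calc (1 + r) ^ (-α) * (r ^ (-m) * |r ^ a * besselJ (ν + a) (l * r)|)
      = (1 + r) ^ (-α) * (l ^ (m - a) *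
          ((l * r) ^ ((a : ℝ) - m) * |besselJ (ν + a) (l * r)|)) := by
        have h1 : l ^ (m - a) * l ^ ((a : ℝ) - m) = 1 := by
          rw [← Real.rpow_add hl]; simp
        have h2 : r ^ ((a : ℝ) - m) = r ^ (-m) * r ^ a := by
          rw [← Real.rpow_natCast, ← Real.rpow_add hr]; ring_nf
        rw [Real.mul_rpow hl.le hr.le, abs_mul, abs_of_pos (pow_pos hr a), h2]
        linear_combination
          (-(1 + r) ^ (-α) * r ^ (-m) * r ^ a * |besselJ (ν + a) (l * r)|) * h1
    _ ≤ (1 + r) ^ (-α) * (l ^ (m - a) * (C * ((1 + l) ^ (a : ℝ) * (1 + r) ^ α))) := by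
        refine mul_le_mul_of_nonneg_left (mul_le_mul_of_nonneg_left ((h _ hlr).trans ?_)
          (by positivity)) (by positivity)
        refine mul_le_mul_of_nonneg_left ?_ hC
        calc (1 + l * r) ^ β ≤ ((1 + l) * (1 + r)) ^ β := by
              gcongr; nlinarith
          _ = (1 + l) ^ β * (1 + r) ^ β := Real.mul_rpow (by positivity) (by positivity)
          _ ≤ (1 + l) ^ (a : ℝ) * (1 + r) ^ α := by
              gcongr <;> linarith
    _ = C * l ^ (m - a) * (1 + l) ^ a := by
        have h1 : (1 + r) ^ (-α) * (1 + r) ^ α = 1 := by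
          rw [← Real.rpow_add (by positivity)]; simp
        rw [Real.rpow_natCast]
        linear_combination (C * l ^ (m - a) * (1 + l) ^ a) * h1

/-- The building blocks `(r s) ^ (-m) λ ^ (-i) (r ^ a J_{ν+a}(λ r)) (s ^ b J_{ν+b}(λ s))` of the
derivatives of the kernel. -/
noncomputable def besselBlock (ν m : ℝ) (i a b : ℕ) : ℝ → ℝ → ℝ → ℝ := fun r s l =>
  (r * s) ^ (-m) * (l ^ (-(i : ℝ)) *
    ((r ^ a * besselJ (ν + a) (l * r)) * (s ^ b * besselJ (ν + b) (l * s))))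

/-- The span of the building blocks of total weight `k`. -/
noncomputable def besselBlockSpan (ν m : ℝ) (k : ℕ) : Submodule ℝ (ℝ → ℝ → ℝ → ℝ) :=
  Submodule.span ℝ {f | ∃ i a b : ℕ, i + a + b = k ∧ f = besselBlock ν m i a b}

lemma besselBlock_mem_span (ν m : ℝ) {i a b k : ℕ} (h : i + a + b = k) :
    besselBlock ν m i a b ∈ besselBlockSpan ν m k :=
  Submodule.subset_span ⟨i, a, b, h, rfl⟩

lemma hasDerivAt_pow_mul_besselJ {ν : ℝ} (hν : 0 ≤ ν) (a : ℕ) {l r : ℝ} (hl : 0 < l)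
    (hr : 0 < r) :
    HasDerivAt (fun l => r ^ a * besselJ (ν + a) (l * r))
      ((ν + a) / l * (r ^ a * besselJ (ν + a) (l * r)) -
        r ^ (a + 1) * besselJ (ν + (a + 1 : ℕ)) (l * r)) l := by
  have h := (hasDerivAt_besselJ (ν := ν + a) (by positivity) (mul_pos hl hr)).comp l
    ((hasDerivAt_id l).mul_const r)
  refine (h.const_mul (r ^ a)).congr_deriv ?_
  push_cast
  rw [← add_assoc]
  field_simp
  ring

lemma hasDerivAt_besselBlock {ν m : ℝ} (hν : 0 ≤ ν) (i a b : ℕ) {l r s : ℝ} (hl : 0 < l)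
    (hr : 0 < r) (hs : 0 < s) :
    HasDerivAt (besselBlock ν m i a b r s)
      ((2 * ν + a + b - i) * besselBlock ν m (i + 1) a b r s l -
        besselBlock ν m i (a + 1) b r s l - besselBlock ν m i a (b + 1) r s l) l := by
  have h := ((Real.hasDerivAt_rpow_const (p := -(i : ℝ)) (Or.inl hl.ne')).mul
    ((hasDerivAt_pow_mul_besselJ hν a hl hr).mul
      (hasDerivAt_pow_mul_besselJ hν b hl hs))).const_mul ((r * s) ^ (-m))
  refine h.congr_deriv ?_
  have hi : l ^ (-((i + 1 : ℕ) : ℝ)) = l ^ (-(i : ℝ)) / l := by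
    rw [← Real.rpow_sub_one hl.ne']; push_cast; ring_nf
  simp only [besselBlock, Pi.mul_apply]
  rw [hi, Real.rpow_sub_one hl.ne']
  field_simp
  ring

lemma exists_hasDerivAt_of_mem_besselBlockSpan {ν m : ℝ} (hν : 0 ≤ ν) {k : ℕ}
    {f : ℝ → ℝ → ℝ → ℝ} (hf : f ∈ besselBlockSpan ν m k) :
    ∃ g ∈ besselBlockSpan ν m (k + 1), ∀ l r s : ℝ, 0 < l → 0 < r → 0 < s →
      HasDerivAt (f r s) (g r s l) l := by
  induction hf using Submodule.span_induction with
  | mem f hf =>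
    obtain ⟨i, a, b, h, rfl⟩ := hf
    refine ⟨(2 * ν + a + b - i) • besselBlock ν m (i + 1) a b - besselBlock ν m i (a + 1) b -
      besselBlock ν m i a (b + 1), ?_, fun l r s hl hr hs => hasDerivAt_besselBlock hν i a b hl hr hs⟩
    exact sub_mem (sub_mem (Submodule.smul_mem _ _ (besselBlock_mem_span ν m (by lia)))
      (besselBlock_mem_span ν m (by lia))) (besselBlock_mem_span ν m (by lia))
  | zero => exact ⟨0, zero_mem _, fun l r s _ _ _ => hasDerivAt_const l 0⟩
  | add f₁ f₂ _ _ h₁ h₂ =>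
    obtain ⟨g₁, hg₁, h₁⟩ := h₁
    obtain ⟨g₂, hg₂, h₂⟩ := h₂
    exact ⟨g₁ + g₂, add_mem hg₁ hg₂, fun l r s hl hr hs =>
      (h₁ l r s hl hr hs).add (h₂ l r s hl hr hs)⟩
  | smul c f _ h =>
    obtain ⟨g, hg, h⟩ := h
    exact ⟨c • g, Submodule.smul_mem _ c hg, fun l r s hl hr hs => (h l r s hl hr hs).const_smul c⟩

lemma exists_iteratedDeriv_besselBlock_eq {ν m : ℝ} (hν : 0 ≤ ν) (k : ℕ) :
    ∃ g ∈ besselBlockSpan ν m k, ∀ l r s : ℝ, 0 < l → 0 < r → 0 < s →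
      iteratedDeriv k (besselBlock ν m 0 0 0 r s) l = g r s l := by
  induction k with
  | zero => exact ⟨_, besselBlock_mem_span ν m (i := 0) (a := 0) (b := 0) rfl,
      fun l r s _ _ _ => by simp⟩
  | succ k ih =>
    obtain ⟨f, hf, h⟩ := ih
    obtain ⟨g, hg, h'⟩ := exists_hasDerivAt_of_mem_besselBlockSpan hν hf
    refine ⟨g, hg, fun l r s hl hr hs => ?_⟩
    rw [iteratedDeriv_succ, ← (h' l r s hl hr hs).deriv]
    refine Filter.EventuallyEq.deriv_eq ?_
    filter_upwards [lt_mem_nhds hl] with y hy using h y r s hy hr hs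

lemma exists_weighted_besselBlock_le {ν m α : ℝ} (hν : 0 ≤ ν) (hm0 : 0 ≤ m) (hm : m ≤ ν)
    {i a b k : ℕ} (hk : i + a + b = k) (hα : max ((k : ℝ) - m - 1 / 2) 0 ≤ α) :
    ∃ C : ℝ, 0 ≤ C ∧ ∀ l r s : ℝ, 0 < l → 0 < r → 0 < s →
      (1 + r) ^ (-α) * (1 + s) ^ (-α) * |besselBlock ν m i a b r s l| ≤
        C * (l ^ (2 * m - k) * (1 + l) ^ k) := by
  have hak : (a : ℝ) ≤ k := by exact_mod_cast (by lia : a ≤ k)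
  have hbk : (b : ℝ) ≤ k := by exact_mod_cast (by lia : b ≤ k)
  obtain ⟨C₁, hC₁, h₁⟩ := exists_weighted_besselJ_le hν hm0 hm a
    ((max_le_max_right 0 (by linarith)).trans hα)
  obtain ⟨C₂, hC₂, h₂⟩ := exists_weighted_besselJ_le hν hm0 hm b
    ((max_le_max_right 0 (by linarith)).trans hα)
  refine ⟨C₁ * C₂, by positivity, fun l r s hl hr hs => ?_⟩
  calc (1 + r) ^ (-α) * (1 + s) ^ (-α) * |besselBlock ν m i a b r s l|
      = l ^ (-(i : ℝ)) * (((1 + r) ^ (-α) * (r ^ (-m) * |r ^ a * besselJ (ν + a) (l * r)|)) *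
          ((1 + s) ^ (-α) * (s ^ (-m) * |s ^ b * besselJ (ν + b) (l * s)|))) := by
        unfold besselBlock
        rw [Real.mul_rpow hr.le hs.le, abs_mul, abs_mul (l ^ (-(i : ℝ))),
          abs_mul (r ^ a * besselJ (ν + a) (l * r)),
          abs_of_pos (by positivity : 0 < r ^ (-m) * s ^ (-m)),
          abs_of_pos (by positivity : 0 < l ^ (-(i : ℝ)))]
        ring
    _ ≤ l ^ (-(i : ℝ)) * ((C₁ * l ^ (m - a) * (1 + l) ^ a) * (C₂ * l ^ (m - b) * (1 + l) ^ b)) := by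
        refine mul_le_mul_of_nonneg_left ?_ (by positivity)
        exact mul_le_mul (h₁ l r hl hr) (h₂ l s hl hs) (by positivity) (by positivity)
    _ = C₁ * C₂ * (l ^ (2 * m - k) * (1 + l) ^ (a + b)) := by
        have : l ^ (2 * m - k) = l ^ (-(i : ℝ)) * l ^ (m - a) * l ^ (m - b) := by
          rw [← Real.rpow_add hl, ← Real.rpow_add hl, ← hk]
          push_cast
          ring_nf
        rw [this, pow_add]
        ring
    _ ≤ C₁ * C₂ * (l ^ (2 * m - k) * (1 + l) ^ k) := by
        gcongr
        · linarith
        · lia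

lemma exists_weighted_le_of_mem_besselBlockSpan {ν m α : ℝ} (hν : 0 ≤ ν) (hm0 : 0 ≤ m)
    (hm : m ≤ ν) {k : ℕ} (hα : max ((k : ℝ) - m - 1 / 2) 0 ≤ α) {f : ℝ → ℝ → ℝ → ℝ}
    (hf : f ∈ besselBlockSpan ν m k) :
    ∃ C : ℝ, 0 ≤ C ∧ ∀ l r s : ℝ, 0 < l → 0 < r → 0 < s →
      (1 + r) ^ (-α) * (1 + s) ^ (-α) * |f r s l| ≤ C * (l ^ (2 * m - k) * (1 + l) ^ k) := by
  induction hf using Submodule.span_induction with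
  | mem f hf =>
    obtain ⟨i, a, b, hk, rfl⟩ := hf
    exact exists_weighted_besselBlock_le hν hm0 hm hk hα
  | zero => exact ⟨0, le_rfl, fun l r s _ _ _ => by simp⟩
  | add f₁ f₂ _ _ h₁ h₂ =>
    obtain ⟨C₁, hC₁, h₁⟩ := h₁
    obtain ⟨C₂, hC₂, h₂⟩ := h₂
    refine ⟨C₁ + C₂, by positivity, fun l r s hl hr hs => ?_⟩
    calc (1 + r) ^ (-α) * (1 + s) ^ (-α) * |(f₁ + f₂) r s l|
        ≤ (1 + r) ^ (-α) * (1 + s) ^ (-α) * (|f₁ r s l| + |f₂ r s l|) := by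
          gcongr; exact abs_add_le _ _
      _ ≤ _ := by rw [mul_add, add_mul]; exact add_le_add (h₁ l r s hl hr hs) (h₂ l r s hl hr hs)
  | smul c f _ h =>
    obtain ⟨C, hC, h⟩ := h
    refine ⟨|c| * C, by positivity, fun l r s hl hr hs => ?_⟩
    have h1 := mul_le_mul_of_nonneg_left (h l r s hl hr hs) (abs_nonneg c)
    rw [show (c • f) r s l = c * f r s l from rfl, abs_mul]
    linarith

theorem imag_resolvent_deriv_weighted_pointwise_bound
    (n : ℕ) (hn : 3 ≤ n) (ν : ℝ) (hν : ((n : ℝ) - 2) / 2 ≤ ν)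
    (k : ℕ) (α : ℝ) (hα : max ((k : ℝ) - ((n : ℝ) - 1) / 2) 0 ≤ α) :
    ∃ C > (0 : ℝ), ∀ lam r s : ℝ, 0 < lam → 0 < r → 0 < s →
      (1 + r) ^ (-α) * (1 + s) ^ (-α) *
          |iteratedDeriv k
              (fun l : ℝ => (r * s) ^ (-(((n : ℝ) - 2) / 2)) *
                (besselJ ν (l * r) * besselJ ν (l * s))) lam|
        ≤ C * lam ^ ((n : ℝ) - 2 - (k : ℝ)) * (1 + lam) ^ (k : ℝ) := by
  set m : ℝ := ((n : ℝ) - 2) / 2 with hm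
  have hn' : (3 : ℝ) ≤ n := by exact_mod_cast hn
  have hm0 : 0 ≤ m := by rw [hm]; linarith
  have hν0 : 0 ≤ ν := hm0.trans hν
  obtain ⟨g, hg, hd⟩ := exists_iteratedDeriv_besselBlock_eq (m := m) hν0 k
  obtain ⟨C, hC, h⟩ := exists_weighted_le_of_mem_besselBlockSpan (α := α) hν0 hm0 hν
    (by convert hα using 2; rw [hm]; ring) hg
  refine ⟨C + 1, by positivity, fun lam r s hl hr hs => ?_⟩
  have hF : (fun l : ℝ => (r * s) ^ (-m) * (besselJ ν (l * r) * besselJ ν (l * s))) =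
      besselBlock ν m 0 0 0 r s := by
    ext l; simp [besselBlock]
  rw [hF, hd lam r s hl hr hs, show (n : ℝ) - 2 = 2 * m by rw [hm]; ring, Real.rpow_natCast,
    mul_assoc (C + 1)]
  refine (h lam r s hl hr hs).trans ?_
  gcongr
  linarith
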